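/- arXiv:1304.3524 — 2 statements merged into one kernel-verified Lean document; each statement's English description precedes it below -/
import Mathlib

section
/- For every integer m ≥ 1, let G be the graph with vertices u, v, w_1, w_2, w_3, y_1, …, y_m together with 2m further vertices, whose edges are: u w_i and w_i v for i = 1, 2, 3; the path u y_1 y_2 ⋯ y_m v; and, for each j = 1, …, m, edges joining y_j to two of the further vertices (so each y_j has exactly two pendant neighbors, and the 2m further vertices are pendant vertices). Then G belongs to 𝒢_{7,−2}: every vertex x of G satisfies ∑_{u' ∈ N(x)} d(u') = 7·d(x) − 2 − d(x)². -/
open Finset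
open scoped Classical

/-- `G ∈ 𝒢_{a,b}`: `G` is connected with at least one edge, and
`∑_{u ∈ N(v)} d(u) = a·d(v) + b − d(v)²` for every vertex `v`. -/
def memClassG {V : Type*} [Fintype V] (G : SimpleGraph V) (a b : ℤ) : Prop :=
  G.Connected ∧ G.edgeSet.Nonempty ∧
    ∀ v : V, (∑ u ∈ G.neighborFinset v, (G.degree u : ℤ)) =
      a * (G.degree v : ℤ) + b - (G.degree v : ℤ) ^ 2

/-- The defining relation of the graph `G₃₂(m)`. Vertices: `Sum.inl 0 = u`,
`Sum.inl 1 = v`, `Sum.inl 2, 3, 4 = w₁, w₂, w₃`, `Sum.inr (j, 0) = y_{j+1}`, and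
`Sum.inr (j, 1)`, `Sum.inr (j, 2)` the two pendant neighbours of `y_{j+1}`.
Relations: `u wᵢ`, `v wᵢ`; `u y₁`; `y_m v`; `y_j y_{j+1}`; and `y_j` to its two
pendant neighbours. -/
def rel32 (m : ℕ) : (Fin 5 ⊕ Fin m × Fin 3) → (Fin 5 ⊕ Fin m × Fin 3) → Prop
  | Sum.inl a, Sum.inl b => (a = 0 ∨ a = 1) ∧ (b = 2 ∨ b = 3 ∨ b = 4)
  | Sum.inl a, Sum.inr (j, t) =>
      (a = 0 ∧ j.val = 0 ∧ t = 0) ∨ (a = 1 ∧ j.val = m - 1 ∧ t = 0)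
  | Sum.inr (j, t), Sum.inr (j', t') =>
      (t = 0 ∧ t' = 0 ∧ j'.val = j.val + 1) ∨ (j = j' ∧ t = 0 ∧ t' ≠ 0)
  | Sum.inr _, Sum.inl _ => False

/-- The graph consisting of two vertices `u, v` joined by three paths of length `2`
(through `w₁, w₂, w₃`) and by the path `u y₁ y₂ ⋯ y_m v`, with two pendant vertices
attached to each `y_j`. -/
def G32 (m : ℕ) : SimpleGraph (Fin 5 ⊕ Fin m × Fin 3) :=
  SimpleGraph.fromRel (rel32 m)

namespace G32

/-- The predecessor of `y_{j+1}` on the path `u y₁ ⋯ y_m v`. -/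
def prev {m : ℕ} (j : Fin m) : Fin 5 ⊕ Fin m × Fin 3 :=
  if j.val = 0 then Sum.inl 0 else Sum.inr (⟨j.val - 1, by omega⟩, 0)

/-- The successor of `y_{j+1}` on the path `u y₁ ⋯ y_m v`. -/
def next {m : ℕ} (j : Fin m) : Fin 5 ⊕ Fin m × Fin 3 :=
  if h : j.val + 1 < m then Sum.inr (⟨j.val + 1, h⟩, 0) else Sum.inl 1

lemma prev_ne_next {m : ℕ} (j : Fin m) : prev j ≠ next j := by
  unfold prev next
  split_ifs <;> simp [Fin.ext_iff]

lemma neighborFinset_u {m : ℕ} (hm : 1 ≤ m) :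
    (G32 m).neighborFinset (Sum.inl 0) =
      {Sum.inl 2, Sum.inl 3, Sum.inl 4, Sum.inr (⟨0, hm⟩, 0)} := by
  ext x
  rw [SimpleGraph.mem_neighborFinset]
  rcases x with a | ⟨j, t⟩
  · fin_cases a <;> simp [G32, rel32]
  · simp [G32, rel32, Fin.ext_iff (a := j)]

lemma neighborFinset_v {m : ℕ} (hm : 1 ≤ m) :
    (G32 m).neighborFinset (Sum.inl 1) =
      {Sum.inl 2, Sum.inl 3, Sum.inl 4, Sum.inr (⟨m - 1, by omega⟩, 0)} := by
  ext x
  rw [SimpleGraph.mem_neighborFinset]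
  rcases x with a | ⟨j, t⟩
  · fin_cases a <;> simp [G32, rel32]
  · simp [G32, rel32, Fin.ext_iff (a := j)]

lemma neighborFinset_w {m : ℕ} {i : Fin 5} (hi : i = 2 ∨ i = 3 ∨ i = 4) :
    (G32 m).neighborFinset (Sum.inl i) = {Sum.inl 0, Sum.inl 1} := by
  ext x
  rw [SimpleGraph.mem_neighborFinset]
  rcases x with a | ⟨j, t⟩
  · rcases hi with rfl | rfl | rfl <;> fin_cases a <;> simp [G32, rel32]
  · rcases hi with rfl | rfl | rfl <;> simp [G32, rel32]

lemma neighborFinset_y {m : ℕ} (j : Fin m) :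
    (G32 m).neighborFinset (Sum.inr (j, 0)) =
      {prev j, next j, Sum.inr (j, 1), Sum.inr (j, 2)} := by
  have hj := j.isLt
  ext x
  rw [SimpleGraph.mem_neighborFinset]
  unfold prev next
  rcases x with a | ⟨k, t⟩
  · split_ifs <;> fin_cases a <;> simp [G32, rel32] <;> omega
  · have hk := k.isLt
    split_ifs <;> fin_cases t <;> simp [G32, rel32, Fin.ext_iff (n := m)] <;> omega

lemma neighborFinset_pendant {m : ℕ} (j : Fin m) {t : Fin 3} (ht : t ≠ 0) :
    (G32 m).neighborFinset (Sum.inr (j, t)) = {Sum.inr (j, 0)} := by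
  ext x
  rw [SimpleGraph.mem_neighborFinset]
  rcases x with a | ⟨k, s⟩
  · simp [G32, rel32, ht]
  · simp only [G32, rel32, SimpleGraph.fromRel_adj, ht,
      mem_singleton, Sum.inr.injEq, Prod.mk.injEq, ne_eq]
    grind

lemma degree_u {m : ℕ} (hm : 1 ≤ m) : (G32 m).degree (Sum.inl 0) = 4 := by
  rw [← SimpleGraph.card_neighborFinset_eq_degree, neighborFinset_u hm]
  simp [card_insert_of_notMem]

lemma degree_v {m : ℕ} (hm : 1 ≤ m) : (G32 m).degree (Sum.inl 1) = 4 := by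
  rw [← SimpleGraph.card_neighborFinset_eq_degree, neighborFinset_v hm]
  simp [card_insert_of_notMem]

lemma degree_w {m : ℕ} {i : Fin 5} (hi : i = 2 ∨ i = 3 ∨ i = 4) :
    (G32 m).degree (Sum.inl i) = 2 := by
  rw [← SimpleGraph.card_neighborFinset_eq_degree, neighborFinset_w hi]
  simp [card_insert_of_notMem]

lemma prev_ne_pendant {m : ℕ} (j k : Fin m) {t : Fin 3} (ht : t ≠ 0) :
    prev j ≠ Sum.inr (k, t) := by
  unfold prev
  split_ifs <;> simp [ht.symm]

lemma next_ne_pendant {m : ℕ} (j k : Fin m) {t : Fin 3} (ht : t ≠ 0) :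
    next j ≠ Sum.inr (k, t) := by
  unfold next
  split_ifs <;> simp [ht.symm]

lemma degree_y {m : ℕ} (j : Fin m) : (G32 m).degree (Sum.inr (j, 0)) = 4 := by
  rw [← SimpleGraph.card_neighborFinset_eq_degree, neighborFinset_y]
  simp [card_insert_of_notMem, prev_ne_next, prev_ne_pendant, next_ne_pendant]

lemma degree_pendant {m : ℕ} (j : Fin m) {t : Fin 3} (ht : t ≠ 0) :
    (G32 m).degree (Sum.inr (j, t)) = 1 := by
  rw [← SimpleGraph.card_neighborFinset_eq_degree, neighborFinset_pendant j ht]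
  simp

lemma degree_prev {m : ℕ} (j : Fin m) : (G32 m).degree (prev j) = 4 := by
  have hm : 1 ≤ m := by have := j.isLt; omega
  by_cases h : j.val = 0
  · rw [prev, if_pos h]
    exact degree_u hm
  · rw [prev, if_neg h]
    exact degree_y _

lemma degree_next {m : ℕ} (j : Fin m) : (G32 m).degree (next j) = 4 := by
  have hm : 1 ≤ m := by have := j.isLt; omega
  by_cases h : j.val + 1 < m
  · rw [next, dif_pos h]
    exact degree_y _
  · rw [next, dif_neg h]
    exact degree_v hm

lemma reachable_y {m : ℕ} (n : ℕ) (hn : n < m) :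
    (G32 m).Reachable (Sum.inl 0) (Sum.inr (⟨n, hn⟩, 0)) := by
  induction n with
  | zero => exact SimpleGraph.Adj.reachable (by simp [G32, rel32])
  | succ n ih =>
    exact (ih (by omega)).trans (SimpleGraph.Adj.reachable (by simp [G32, rel32]))

lemma reachable {m : ℕ} (x : Fin 5 ⊕ Fin m × Fin 3) :
    (G32 m).Reachable (Sum.inl 0) x := by
  have huw : (G32 m).Adj (Sum.inl 0) (Sum.inl 2) := by simp [G32, rel32]
  rcases x with a | ⟨j, t⟩
  · by_cases h1 : a = 1
    · subst h1
      exact huw.reachable.trans (SimpleGraph.Adj.reachable (by simp [G32, rel32]))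
    · by_cases h0 : a = 0
      · subst h0; rfl
      · refine SimpleGraph.Adj.reachable ?_
        fin_cases a <;> simp_all [G32, rel32]
  · refine (reachable_y j.val j.isLt).trans ?_
    by_cases ht : t = 0
    · subst ht; rfl
    · exact SimpleGraph.Adj.reachable (by simp [G32, rel32, ht, Ne.symm ht])

lemma connected (m : ℕ) : (G32 m).Connected :=
  (SimpleGraph.connected_iff_exists_forall_reachable _).2 ⟨Sum.inl 0, reachable⟩

end G32

open G32

/-- For every `m ≥ 1`, the graph `G₃₂(m)` belongs to `𝒢_{7,−2}`. -/
theorem G32_mem : ∀ m : ℕ, 1 ≤ m → memClassG (G32 m) 7 (-2) := by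
  intro m hm
  refine ⟨connected m, ⟨s(Sum.inl 0, Sum.inl 2), by simp [G32, rel32]⟩, ?_⟩
  have hw2 := degree_w (m := m) (i := 2) (by decide)
  have hw3 := degree_w (m := m) (i := 3) (by decide)
  have hw4 := degree_w (m := m) (i := 4) (by decide)
  rintro (a | ⟨j, t⟩)
  · have ha : a = 0 ∨ a = 1 ∨ (a = 2 ∨ a = 3 ∨ a = 4) := by revert a; decide
    rcases ha with rfl | rfl | ha
    · rw [neighborFinset_u hm, degree_u hm]
      simp [sum_insert, hw2, hw3, hw4, degree_y]
    · rw [neighborFinset_v hm, degree_v hm]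
      simp [sum_insert, hw2, hw3, hw4, degree_y]
    · rw [neighborFinset_w ha, degree_w ha]
      simp [sum_insert, degree_u hm, degree_v hm]
  · by_cases ht : t = 0
    · subst ht
      rw [neighborFinset_y, degree_y]
      simp [sum_insert, prev_ne_next, prev_ne_pendant, next_ne_pendant, degree_prev,
        degree_next, degree_pendant]
    · rw [neighborFinset_pendant j ht, degree_pendant j ht]
      simp [degree_y]
end

section
/- For every integer k ≥ 1, the graph obtained from the complete graph K_4 by attaching exactly k pendant vertices to each of its four vertices belongs to 𝒢_{k+7,−3}: every vertex v of this graph satisfies ∑_{u ∈ N(v)} d(u) = (k+7)·d(v) − 3 − d(v)². -/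
open Finset
open scoped Classical

/-- The defining relation of `K₄` with `k` pendant vertices attached to each of its
four vertices: the vertices of `K₄` are `Sum.inl i`, and `Sum.inr (i, t)` for
`t : Fin k` are the `k` pendant vertices attached to `Sum.inl i`. -/
def relK4Pendants (k : ℕ) : (Fin 4 ⊕ Fin 4 × Fin k) → (Fin 4 ⊕ Fin 4 × Fin k) → Prop
  | Sum.inl _, Sum.inl _ => True
  | Sum.inl a, Sum.inr (i, _) => a = i
  | Sum.inr _, _ => False

/-- The graph obtained from `K₄` by attaching exactly `k` pendant vertices to each of
its four vertices. -/
def K4Pendants (k : ℕ) : SimpleGraph (Fin 4 ⊕ Fin 4 × Fin k) :=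
  SimpleGraph.fromRel (relK4Pendants k)

theorem K4Pendants_adj_inl_inl {k : ℕ} (i j : Fin 4) :
    (K4Pendants k).Adj (Sum.inl i) (Sum.inl j) ↔ i ≠ j := by
  simp [K4Pendants, relK4Pendants]

theorem K4Pendants_adj_inl_inr {k : ℕ} (i : Fin 4) (p : Fin 4 × Fin k) :
    (K4Pendants k).Adj (Sum.inl i) (Sum.inr p) ↔ i = p.1 := by
  simp [K4Pendants, relK4Pendants]

theorem K4Pendants_adj_inr_inl {k : ℕ} (p : Fin 4 × Fin k) (i : Fin 4) :
    (K4Pendants k).Adj (Sum.inr p) (Sum.inl i) ↔ i = p.1 := by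
  rw [SimpleGraph.adj_comm, K4Pendants_adj_inl_inr]

theorem K4Pendants_not_adj_inr_inr {k : ℕ} (p q : Fin 4 × Fin k) :
    ¬ (K4Pendants k).Adj (Sum.inr p) (Sum.inr q) := by
  simp [K4Pendants, relK4Pendants]

theorem K4Pendants_neighborFinset_inl {k : ℕ} (i : Fin 4) :
    (K4Pendants k).neighborFinset (Sum.inl i) =
      (univ.erase i).disjSum (({i} : Finset (Fin 4)) ×ˢ (univ : Finset (Fin k))) := by
  ext (j | p)
  · simp [K4Pendants_adj_inl_inl, eq_comm]
  · rw [SimpleGraph.mem_neighborFinset, K4Pendants_adj_inl_inr, inr_mem_disjSum, mem_product]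
    simp [eq_comm]

theorem K4Pendants_neighborFinset_inr {k : ℕ} (p : Fin 4 × Fin k) :
    (K4Pendants k).neighborFinset (Sum.inr p) = {Sum.inl p.1} := by
  ext (j | q)
  · simp [K4Pendants_adj_inr_inl]
  · simp [K4Pendants_not_adj_inr_inr]

theorem K4Pendants_degree_inl {k : ℕ} (i : Fin 4) :
    (K4Pendants k).degree (Sum.inl i) = k + 3 := by
  rw [← SimpleGraph.card_neighborFinset_eq_degree, K4Pendants_neighborFinset_inl]
  simp [add_comm]

theorem K4Pendants_degree_inr {k : ℕ} (p : Fin 4 × Fin k) :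
    (K4Pendants k).degree (Sum.inr p) = 1 := by
  rw [← SimpleGraph.card_neighborFinset_eq_degree, K4Pendants_neighborFinset_inr]
  simp

theorem K4Pendants_connected (k : ℕ) : (K4Pendants k).Connected := by
  have core (i : Fin 4) : (K4Pendants k).Reachable (Sum.inl 0) (Sum.inl i) := by
    by_cases h : 0 = i
    · rw [h]
    · exact ((K4Pendants_adj_inl_inl 0 i).2 h).reachable
  refine SimpleGraph.connected_iff_exists_forall_reachable _ |>.2 ⟨Sum.inl 0, ?_⟩
  rintro (i | p)
  · exact core i
  · exact (core p.1).trans ((K4Pendants_adj_inl_inr p.1 p).2 rfl).reachable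

/-- For every `k ≥ 1`, the graph obtained from `K₄` by attaching exactly `k` pendant
vertices to each of its four vertices belongs to `𝒢_{k+7,−3}`. -/
theorem K4Pendants_mem : ∀ k : ℕ, 1 ≤ k → memClassG (K4Pendants k) ((k : ℤ) + 7) (-3) := by
  intro k _
  refine ⟨K4Pendants_connected k, ⟨s(Sum.inl 0, Sum.inl 1), ?_⟩, ?_⟩
  · rw [SimpleGraph.mem_edgeSet, K4Pendants_adj_inl_inl]
    decide
  · rintro (i | p)
    · rw [K4Pendants_neighborFinset_inl, sum_disjSum]
      simp only [K4Pendants_degree_inl, K4Pendants_degree_inr, sum_const]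
      simp
      ring
    · rw [K4Pendants_neighborFinset_inr, sum_singleton, K4Pendants_degree_inl,
        K4Pendants_degree_inr]
      push_cast
      ring
end
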